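/- Let R be a commutative ring, q ∈ R, and let a, b : ℕ → R be two sequences. Then a_n = Σ_{k=0}^{n} [n choose k]_q · b_k holds for all n ≥ 0 if and only if b_n = Σ_{k=0}^{n} (−1)^{n−k} [n choose k]_q · q^{C(n−k,2)} · a_k holds for all n ≥ 0, where C(m,2) = m(m−1)/2 and the Gaussian binomial coefficients are evaluated at q. -/

import Mathlib

/-- The Gaussian binomial coefficient `[n choose k]_q`, defined by the
q-Pascal recurrence `[n+1, k+1] = [n, k] + q^{k+1}·[n, k+1]`; it equals
`((1-q^n)⋯(1-q^{n-k+1}))/((1-q^k)⋯(1-q))` for `0 ≤ k ≤ n` and `0` for `k > n`. -/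
def qBinom {R : Type*} [CommRing R] (q : R) : ℕ → ℕ → R
  | _, 0 => 1
  | 0, _ + 1 => 0
  | n + 1, k + 1 => qBinom q n k + q ^ (k + 1) * qBinom q n (k + 1)

open Polynomial in
/-- The polynomial `(X - 1)(X - q)⋯(X - q^{n-1})`. -/
noncomputable def qFallingFactorial {R : Type*} [CommRing R] (q : R) (n : ℕ) : R[X] :=
  ∏ i ∈ Finset.range n, (X - C (q ^ i))

theorem qBinom_zero_right {R : Type*} [CommRing R] (q : R) (n : ℕ) : qBinom q n 0 = 1 := by
  cases n <;> rfl

theorem qBinom_succ_succ {R : Type*} [CommRing R] (q : R) (n k : ℕ) :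
    qBinom q (n + 1) (k + 1) = qBinom q n k + q ^ (k + 1) * qBinom q n (k + 1) := rfl

theorem qBinom_eq_zero_of_lt {R : Type*} [CommRing R] (q : R) {n k : ℕ} (h : n < k) :
    qBinom q n k = 0 := by
  induction n generalizing k with
  | zero =>
    obtain ⟨k, rfl⟩ := Nat.exists_eq_succ_of_ne_zero h.ne'
    rfl
  | succ n ih =>
    obtain ⟨k, rfl⟩ := Nat.exists_eq_succ_of_ne_zero (Nat.ne_zero_of_lt h)
    rw [Nat.succ_eq_add_one, qBinom_succ_succ, ih (by omega), ih (by omega)]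
    simp

theorem qBinom_self {R : Type*} [CommRing R] (q : R) (n : ℕ) : qBinom q n n = 1 := by
  induction n with
  | zero => rfl
  | succ n ih => rw [qBinom_succ_succ, ih, qBinom_eq_zero_of_lt q n.lt_succ_self]; simp

open Polynomial in
theorem qFallingFactorial_succ {R : Type*} [CommRing R] (q : R) (n : ℕ) :
    qFallingFactorial q (n + 1) = qFallingFactorial q n * (X - C (q ^ n)) :=
  Finset.prod_range_succ _ _

open Polynomial in
theorem X_pow_eq_sum_qFallingFactorial {R : Type*} [CommRing R] (q : R) (n : ℕ) :
    (X : R[X]) ^ n = ∑ k ∈ Finset.range (n + 1), qBinom q n k • qFallingFactorial q k := by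
  induction n with
  | zero => simp [qBinom_zero_right, qFallingFactorial]
  | succ n ih =>
    have hX (k : ℕ) : qFallingFactorial q k * X =
        qFallingFactorial q (k + 1) + q ^ k • qFallingFactorial q k := by
      rw [qFallingFactorial_succ, smul_eq_C_mul]; ring
    have hshift : ∑ k ∈ Finset.range (n + 1), (qBinom q n k * q ^ k) • qFallingFactorial q k =
        qFallingFactorial q 0 + ∑ k ∈ Finset.range (n + 1),
          (qBinom q n (k + 1) * q ^ (k + 1)) • qFallingFactorial q (k + 1) := by
      rw [Finset.sum_range_succ', Finset.sum_range_succ _ n,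
        qBinom_eq_zero_of_lt q n.lt_succ_self]
      simp [qBinom_zero_right, add_comm]
    rw [pow_succ, ih, Finset.sum_mul]
    simp_rw [smul_mul_assoc, hX, smul_add, smul_smul]
    rw [Finset.sum_add_distrib, hshift, Finset.sum_range_succ' _ (n + 1)]
    simp_rw [qBinom_succ_succ, add_smul, Finset.sum_add_distrib, qBinom_zero_right, one_smul,
      mul_comm (q ^ _)]
    abel

theorem coeff_qFallingFactorial {R : Type*} [CommRing R] (q : R) (n k : ℕ) :
    (qFallingFactorial q n).coeff k =
      (-1 : R) ^ (n - k) * qBinom q n k * q ^ Nat.choose (n - k) 2 := by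
  induction n generalizing k with
  | zero =>
    cases k with
    | zero => simp [qFallingFactorial, qBinom_zero_right]
    | succ k => simp [qFallingFactorial, Polynomial.coeff_one, qBinom]
  | succ n ih =>
    rw [qFallingFactorial_succ, mul_sub, Polynomial.coeff_sub, Polynomial.coeff_mul_C]
    cases k with
    | zero =>
      rw [Polynomial.coeff_mul_X_zero, ih, qBinom_zero_right, qBinom_zero_right]
      simp only [Nat.sub_zero, Nat.choose_succ_succ' n 1, Nat.choose_one_right]
      ring
    | succ k =>
      rw [Polynomial.coeff_mul_X, ih, ih, qBinom_succ_succ, Nat.add_sub_add_right]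
      rcases lt_or_ge k n with h | h
      · obtain ⟨m, rfl⟩ := Nat.exists_eq_add_of_lt h
        have h₁ : k + m + 1 - k = m + 1 := by omega
        have h₂ : k + m + 1 - (k + 1) = m := by omega
        rw [h₁, h₂, Nat.choose_succ_succ' m 1, Nat.choose_one_right]
        ring
      · rw [qBinom_eq_zero_of_lt q (Nat.lt_succ_of_le h)]
        ring

open Polynomial in
theorem qFallingFactorial_eq_sum {R : Type*} [CommRing R] (q : R) (n : ℕ) :
    qFallingFactorial q n = ∑ k ∈ Finset.range (n + 1),
      ((-1 : R) ^ (n - k) * qBinom q n k * q ^ Nat.choose (n - k) 2) • (X : R[X]) ^ k := by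
  have hdeg : (qFallingFactorial q n).natDegree < n + 1 := by
    rw [Nat.lt_succ_iff, natDegree_le_iff_coeff_eq_zero]
    intro k hk
    rw [coeff_qFallingFactorial, qBinom_eq_zero_of_lt q hk]
    simp
  conv_lhs => rw [as_sum_range_C_mul_X_pow' _ hdeg]
  simp_rw [coeff_qFallingFactorial, smul_eq_C_mul]

/-- q-binomial inversion. -/
theorem qBinom_inversion {R : Type*} [CommRing R] (q : R) (a b : ℕ → R) :
    (∀ n : ℕ, a n = ∑ k ∈ Finset.range (n + 1), qBinom q n k * b k) ↔
    (∀ n : ℕ, b n = ∑ k ∈ Finset.range (n + 1),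
        (-1 : R) ^ (n - k) * qBinom q n k * q ^ Nat.choose (n - k) 2 * a k) := by
  obtain ⟨L, hL⟩ : ∃ L : Polynomial R →ₗ[R] R, ∀ n, L (Polynomial.X ^ n) = a n :=
    ⟨(Polynomial.basisMonomials R).constr R a, fun n => by
      have h := (Polynomial.basisMonomials R).constr_basis R a n
      simp only [Polynomial.coe_basisMonomials] at h
      rwa [← Polynomial.X_pow_eq_monomial] at h⟩
  have ha (n : ℕ) : a n =
      ∑ k ∈ Finset.range (n + 1), qBinom q n k * L (qFallingFactorial q k) := by
    rw [← hL, X_pow_eq_sum_qFallingFactorial q, map_sum]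
    simp_rw [map_smul, smul_eq_mul]
  have hb (n : ℕ) : L (qFallingFactorial q n) = ∑ k ∈ Finset.range (n + 1),
      (-1 : R) ^ (n - k) * qBinom q n k * q ^ Nat.choose (n - k) 2 * a k := by
    rw [qFallingFactorial_eq_sum, map_sum]
    simp_rw [map_smul, smul_eq_mul, hL]
  simp_rw [← hb]
  refine ⟨fun h n => ?_, fun h n => by simp_rw [h]; exact ha n⟩
  induction n using Nat.strong_induction_on with
  | _ n ih =>
    have heq := (h n).symm.trans (ha n)
    rw [Finset.sum_range_succ, Finset.sum_range_succ, qBinom_self, one_mul, one_mul,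
      Finset.sum_congr rfl fun k hk => by rw [ih k (Finset.mem_range.mp hk)]] at heq
    exact add_left_cancel heq
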